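/- For every n ≥ 3 and every r with 2 ≤ r ≤ n − 1, the maximum of ℓ(A, α) over all acyclic simple digraphs A on {1,…,n} and all α ∈ ⟨A⟩ of rank r equals (n−r)(n+r−3)/2 + 1. Consequently, the maximum of ℓ(A, α) over all acyclic simple digraphs A on {1,…,n} and all α ∈ ⟨A⟩ equals (n² − 3n + 4)/2, attained at rank r = 2. -/

import Mathlib

noncomputable section

variable {V : Type*}

/-- The arc `(a→b)`: the map sending `a` to `b` and fixing every other point. -/
def arcMap [DecidableEq V] (a b : V) : V → V := fun x => if x = a then b else x

/-- Evaluate a word of arcs, applying the arcs from left to right. -/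
def wordEval [DecidableEq V] (w : List (V × V)) : V → V :=
  fun x => w.foldl (fun y e => arcMap e.1 e.2 y) x

/-- `α ∈ ⟨D⟩`: `α` is a (nonempty) product of arcs of the digraph `D`. -/
def InGen [DecidableEq V] (D : V → V → Prop) (α : V → V) : Prop :=
  ∃ w : List (V × V), w ≠ [] ∧ (∀ e ∈ w, D e.1 e.2) ∧ wordEval w = α

/-- `ℓ(D, α)`: the minimal length of a word in the arcs of `D` expressing `α`. -/
def arcLen [DecidableEq V] (D : V → V → Prop) (α : V → V) : ℕ :=
  sInf {k | ∃ w : List (V × V), w.length = k ∧ (∀ e ∈ w, D e.1 e.2) ∧ wordEval w = α}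

/-- `fix(α)`: the number of fixed points of `α`. -/
def fixCnt (α : V → V) : ℕ := Set.ncard {x | α x = x}

/-- `rk(α)`: the rank of `α`, i.e. the cardinality of its image. -/
def rnk (α : V → V) : ℕ := Set.ncard (Set.range α)

/-- A set `C` is a cyclic orbit of `α` if it is a weakly connected component of the
functional digraph of `α` (edges `(x, α x)`) which is a directed cycle on at least two
vertices: equivalently, `C` is the forward orbit of a periodic point, has at least two
elements, and is closed under taking preimages. -/
def IsCyclicOrbit (α : V → V) (C : Set V) : Prop :=
  2 ≤ C.ncard ∧ (∃ x ∈ C, (∃ k, 0 < k ∧ α^[k] x = x) ∧ C = {y | ∃ k, α^[k] x = y}) ∧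
    ∀ y : V, α y ∈ C → y ∈ C

/-- `cycl(α)`: the number of cyclic orbits of `α`. -/
def cyclCnt (α : V → V) : ℕ := Set.ncard {C : Set V | IsCyclicOrbit α C}

/-- `D` is connected: any two vertices are joined by a directed path in some direction. -/
def ConnectedDigraph (D : V → V → Prop) : Prop :=
  ∀ u v : V, Relation.ReflTransGen D u v ∨ Relation.ReflTransGen D v u

/-- `D` is closed (equal to its closure): whenever `(b,a)` is an edge lying on a directed
cycle of `D` (i.e. there is a directed path from `a` back to `b`), `(a,b)` is also an edge. -/
def ClosedDigraph (D : V → V → Prop) : Prop :=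
  ∀ a b : V, D b a → Relation.ReflTransGen D a b → D a b

/-- Property (★): if `v0, v1, v2` is a directed path with `d_D(v0,v2) = 2`, then every
out-neighbour of `v1` and of `v2` lies in `{v0, v1, v2}`. -/
def StarCond (D : V → V → Prop) : Prop :=
  ∀ v0 v1 v2 : V, D v0 v1 → D v1 v2 → v0 ≠ v2 → ¬ D v0 v2 →
    ∀ u : V, (D v1 u ∨ D v2 u) → (u = v0 ∨ u = v1 ∨ u = v2)

/-- `C` is a strong component of `D`. -/
def IsSC (D : V → V → Prop) (C : Set V) : Prop :=
  ∃ v : V, C = {u | Relation.ReflTransGen D u v ∧ Relation.ReflTransGen D v u}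

/-- `C1` connects to `C2`: some edge goes from `C1` to `C2`. -/
def ConnectsTo (D : V → V → Prop) (C1 C2 : Set V) : Prop :=
  ∃ v1 ∈ C1, ∃ v2 ∈ C2, D v1 v2

/-- `C1` fully connects to `C2`: all pairs are edges. -/
def FullyConnects (D : V → V → Prop) (C1 C2 : Set V) : Prop :=
  ∀ v1 ∈ C1, ∀ v2 ∈ C2, D v1 v2

/-- A terminal strong component: it connects to no other strong component. -/
def IsTerminalSC (D : V → V → Prop) (C : Set V) : Prop :=
  IsSC D C ∧ ∀ C' : Set V, IsSC D C' → C' ≠ C → ¬ ConnectsTo D C C'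

/-- Property (★★): nonterminal strong components have at most 2 vertices and terminal
strong components have at most 3 vertices. -/
def StarStarCond (D : V → V → Prop) : Prop :=
  ∀ C : Set V, IsSC D C →
    (IsTerminalSC D C → C.ncard ≤ 3) ∧ (¬ IsTerminalSC D C → C.ncard ≤ 2)

/-- The induced subdigraph on `C` is an undirected path `a - b - c` on three vertices. -/
def IsP3 (D : V → V → Prop) (C : Set V) : Prop :=
  ∃ a b c : V, a ≠ b ∧ b ≠ c ∧ a ≠ c ∧ C = {a, b, c} ∧
    ∀ u ∈ C, ∀ w ∈ C,
      (D u w ↔ (u = a ∧ w = b) ∨ (u = b ∧ w = a) ∨ (u = b ∧ w = c) ∨ (u = c ∧ w = b))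

/-- `D` has a subdigraph isomorphic to `H`: an injection mapping edges of `H` to edges of `D`. -/
def HasSubdigraph (D : V → V → Prop) {m : ℕ} (H : Fin m → Fin m → Prop) : Prop :=
  ∃ f : Fin m → V, Function.Injective f ∧ ∀ i j : Fin m, H i j → D (f i) (f j)

/-- `Θ_k`: the directed cycle on `k` vertices. -/
def Theta (k : ℕ) : Fin k → Fin k → Prop := fun i j => (j : ℕ) = ((i : ℕ) + 1) % k

/-- `Γ1` (vertices relabelled from `{1,…,5}` to `{0,…,4}`). -/
def Gamma1 : Fin 5 → Fin 5 → Prop := fun i j =>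
  ((i : ℕ), (j : ℕ)) ∈ [(0,3),(3,0),(1,3),(3,1),(2,3),(3,2),(3,4)]

/-- `Γ2` (vertices relabelled from `{1,…,5}` to `{0,…,4}`). -/
def Gamma2 : Fin 5 → Fin 5 → Prop := fun i j =>
  ((i : ℕ), (j : ℕ)) ∈ [(0,2),(2,0),(1,2),(2,1),(2,3),(3,2),(3,4)]

/-- `Γ3` (vertices relabelled from `{1,…,4}` to `{0,…,3}`). -/
def Gamma3 : Fin 4 → Fin 4 → Prop := fun i j =>
  ((i : ℕ), (j : ℕ)) ∈ [(0,1),(1,2),(2,0),(2,3)]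

/-- `Γ4` (vertices relabelled from `{1,…,5}` to `{0,…,4}`). -/
def Gamma4 : Fin 5 → Fin 5 → Prop := fun i j =>
  ((i : ℕ), (j : ℕ)) ∈ [(0,1),(1,2),(2,3),(3,0),(3,4)]

/-- No subdigraph isomorphic to `Γ1`, `Γ2`, `Γ3`, `Γ4` or `Θ_k` for `k ≥ 5`. -/
def ForbiddenFree (D : V → V → Prop) : Prop :=
  ¬ HasSubdigraph D Gamma1 ∧ ¬ HasSubdigraph D Gamma2 ∧ ¬ HasSubdigraph D Gamma3 ∧
    ¬ HasSubdigraph D Gamma4 ∧ ∀ k : ℕ, 5 ≤ k → ¬ HasSubdigraph D (Theta k)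

/-- `D` is acyclic: it has no directed cycle. -/
def AcyclicRel (D : V → V → Prop) : Prop := ∀ v : V, ¬ Relation.TransGen D v v

/-- `ψ_A(u,w)`: the maximal number of edges of a directed path from `u` to `w` in `A`
(in particular `ψ_A(u,u) = 0`). -/
def psiLongest (A : V → V → Prop) (u w : V) : ℕ :=
  sSup {l | ∃ p : List V, p.Chain' A ∧ p.Nodup ∧
    p.head? = some u ∧ p.getLast? = some w ∧ p.length = l + 1}

/-- `d_D(u,w)`: the minimal number of edges of a directed path from `u` to `w` in `D`. -/
def ddist (D : V → V → Prop) (u w : V) : ℕ :=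
  sInf {l | ∃ p : List V, p.Chain' D ∧ p.head? = some u ∧ p.getLast? = some w ∧
    p.length = l + 1}

/-- A tournament: no loops, and exactly one of `(u,v)`, `(v,u)` is an edge for `u ≠ v`. -/
def IsTournament (D : V → V → Prop) : Prop :=
  (∀ v : V, ¬ D v v) ∧ ∀ u v : V, u ≠ v → (D u v ∨ D v u) ∧ ¬ (D u v ∧ D v u)

/-- A strong (strongly connected) digraph. -/
def IsStrongDigraph (D : V → V → Prop) : Prop :=
  ∀ u v : V, Relation.ReflTransGen D u v

theorem wordEval_cons [DecidableEq V] (e : V × V) (w : List (V × V)) (x : V) :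
    wordEval (e :: w) x = wordEval w (arcMap e.1 e.2 x) := rfl

theorem wordEval_append [DecidableEq V] (w₁ w₂ : List (V × V)) (x : V) :
    wordEval (w₁ ++ w₂) x = wordEval w₂ (wordEval w₁ x) := by
  simp [wordEval]

theorem arcMap_of_ne [DecidableEq V] {a b x : V} (h : x ≠ a) : arcMap a b x = x := if_neg h

theorem arcMap_self [DecidableEq V] (a b : V) : arcMap a b a = b := if_pos rfl

theorem wordEval_eq_self [DecidableEq V] {w : List (V × V)} {x : V} (h : ∀ e ∈ w, e.1 ≠ x) :
    wordEval w x = x := by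
  induction w with
  | nil => rfl
  | cons e w ih =>
    rw [wordEval_cons, arcMap_of_ne (h e (by simp)).symm]
    exact ih fun e' he' => h e' (by simp [he'])

/-- The sum of `0, 0, 1, 2, …`, with `n` terms. -/
def predSum (n : ℕ) : ℕ := ∑ i ∈ Finset.range n, (i - 1)

theorem two_mul_predSum {n : ℕ} (hn : 1 ≤ n) : 2 * predSum n = (n - 1) * (n - 2) := by
  induction n, hn using Nat.le_induction with
  | base => simp [predSum]
  | succ n hn ih =>
    rw [predSum, Finset.sum_range_succ, mul_add, ← predSum, ih]
    obtain ⟨k, rfl⟩ := Nat.exists_eq_add_of_le' hn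
    rcases k with _ | k
    · simp
    · simp only [Nat.add_sub_cancel, show k + 1 + 1 - 2 = k by omega,
        show k + 1 + 1 + 1 - 2 = k + 1 by omega]
      ring

theorem predSum_card_le_sum (s : Finset ℕ) : predSum s.card ≤ ∑ x ∈ s, (x - 1) := by
  induction s using Finset.induction_on_max with
  | empty => simp [predSum]
  | insert a s ha ih =>
    have hns : a ∉ s := fun h => lt_irrefl a (ha a h)
    have hcard : s.card ≤ a := by
      simpa using Finset.card_le_card (fun x hx => Finset.mem_range.2 (ha x hx))
    rw [Finset.card_insert_of_notMem hns, Finset.sum_insert hns, predSum,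
      Finset.sum_range_succ, ← predSum]
    omega

section UpperBound

variable [DecidableEq V]

/-- An arc leaving the second vertex of a topological order is redundant as soon as a later arc
leaves that vertex. -/
theorem wordEval_of_bottom {p : V → ℕ} (hp : Function.Injective p) {w : List (V × V)}
    (hw : ∀ e ∈ w, p e.2 < p e.1) (hbot : ∃ e ∈ w, p e.1 = 1) {a b : V} (ha : p a = 1)
    (hb : p b = 0) : wordEval w a = b := by
  induction w with
  | nil => simp at hbot
  | cons e w ih =>
    have he := hw e (by simp)
    rw [wordEval_cons]
    by_cases h : a = e.1
    · subst h
      have : e.2 = b := hp (by omega)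
      rw [arcMap_self, this]
      refine wordEval_eq_self fun e' he' h' => ?_
      have := hw e' (by simp [he'])
      rw [h'] at this
      omega
    · rw [arcMap_of_ne h]
      refine ih (fun e' he' => hw e' (by simp [he'])) ?_
      obtain ⟨e', he', h1⟩ := hbot
      rcases List.mem_cons.1 he' with rfl | he'
      · exact absurd (hp (ha.trans h1.symm)) h
      · exact ⟨e', he', h1⟩

theorem sum_image_arcMap_add_le {p : V → ℕ} {a b : V} (hab : p b < p a) {S : Finset V}
    (ha : a ∈ S) :
    ∑ x ∈ S.image (arcMap a b), (p x - 1) + (if p a = 1 then 0 else 1) ≤ ∑ x ∈ S, (p x - 1) := by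
  have hsub : S.image (arcMap a b) ⊆ insert b (S.erase a) := by
    intro y hy
    obtain ⟨x, hx, rfl⟩ := Finset.mem_image.1 hy
    by_cases h : x = a
    · simp [h, arcMap_self]
    · simp [arcMap_of_ne h, h, hx]
  have h1 := Finset.sum_le_sum_of_subset (f := fun x => p x - 1) hsub
  have h2 : ∑ x ∈ insert b (S.erase a), (p x - 1) ≤ (p b - 1) + ∑ x ∈ S.erase a, (p x - 1) := by
    by_cases hb : b ∈ S.erase a
    · rw [Finset.insert_eq_of_mem hb]; omega
    · rw [Finset.sum_insert hb]
  have h3 := Finset.add_sum_erase S (fun x => p x - 1) ha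
  split_ifs <;> omega

theorem exists_short_word {p : V → ℕ} (hp : Function.Injective p) (w : List (V × V))
    (hw : ∀ e ∈ w, p e.2 < p e.1) (S : Finset V) :
    ∃ w' : List (V × V), w' ⊆ w ∧ (∀ x ∈ S, wordEval w' x = wordEval w x) ∧
      w'.length + ∑ x ∈ S.image (wordEval w), (p x - 1) ≤
        ∑ x ∈ S, (p x - 1) + (if ∃ e ∈ w', p e.1 = 1 then 1 else 0) := by
  induction w generalizing S with
  | nil => exact ⟨[], by simp, by simp, by simp [show wordEval ([] : List (V × V)) = id from rfl]⟩
  | cons e w ih =>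
    have he := hw e (by simp)
    have hw' : ∀ e ∈ w, p e.2 < p e.1 := fun e' he' => hw e' (by simp [he'])
    obtain ⟨w', hsub, heval, hlen⟩ := ih hw' (S.image (arcMap e.1 e.2))
    have himg : (S.image (arcMap e.1 e.2)).image (wordEval w) = S.image (wordEval (e :: w)) := by
      rw [Finset.image_image]; rfl
    rw [himg] at hlen
    have hsub' : w' ⊆ e :: w := fun _ h => List.mem_cons_of_mem _ (hsub h)
    have heval' : ∀ x ∈ S, wordEval w' (arcMap e.1 e.2 x) = wordEval (e :: w) x :=
      fun x hx => heval _ (Finset.mem_image_of_mem _ hx)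
    by_cases hS : e.1 ∈ S
    · have hdrop := sum_image_arcMap_add_le he hS
      by_cases hbot : p e.1 = 1 ∧ ∃ e' ∈ w', p e'.1 = 1
      · refine ⟨w', hsub', fun x hx => ?_, ?_⟩
        · rw [← heval' x hx]
          by_cases hxe : x = e.1
          · rw [hxe, arcMap_self, wordEval_of_bottom hp (fun e' h => hw' e' (hsub h)) hbot.2
              hbot.1 (b := e.2) (by omega)]
            refine (wordEval_eq_self fun e' h h' => ?_).symm
            have := hw' e' (hsub h)
            rw [h'] at this
            omega
          · rw [arcMap_of_ne hxe]
        · omega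
      · refine ⟨e :: w', by simpa using hsub', heval', ?_⟩
        rw [List.length_cons]
        by_cases h1 : p e.1 = 1
        · have h2 : ¬ ∃ e' ∈ w', p e'.1 = 1 := fun h => hbot ⟨h1, h⟩
          rw [if_pos ⟨e, by simp, h1⟩]
          rw [if_neg h2] at hlen
          omega
        · have h2 : (∃ e' ∈ e :: w', p e'.1 = 1) ↔ ∃ e' ∈ w', p e'.1 = 1 := by simp [h1]
          simp only [h2]
          rw [if_neg h1] at hdrop
          omega
    · have hfix : ∀ x ∈ S, arcMap e.1 e.2 x = x := fun x hx =>
        arcMap_of_ne fun h => hS (h ▸ hx)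
      have hSS : S.image (arcMap e.1 e.2) = S := by
        rw [Finset.image_congr (g := id) (fun x hx => hfix x hx), Finset.image_id]
      rw [hSS] at hlen
      exact ⟨w', hsub', fun x hx => by rw [← heval' x hx, hfix x hx], hlen⟩

end UpperBound

theorem exists_strictMono_equiv_fin [Fintype V] [PartialOrder V] {n : ℕ}
    (hn : Fintype.card V = n) : ∃ σ : V ≃ Fin n, StrictMono σ := by
  let : Fintype (LinearExtension V) := ‹Fintype V›
  let φ : LinearExtension V ≃o Fin n := (monoEquivOfFin (LinearExtension V) hn).symm
  have hinj : Function.Injective fun a : V => φ (toLinearExtension a) :=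
    fun a b hab => φ.injective hab
  exact ⟨Equiv.ofBijective _ ((Fintype.bijective_iff_injective_and_card _).2 ⟨hinj, by simp [hn]⟩),
    Monotone.strictMono_of_injective
      (fun a b hab => φ.monotone (toLinearExtension.monotone hab)) hinj⟩

theorem AcyclicRel.exists_topological_order [Fintype V] {n : ℕ} (hn : Fintype.card V = n)
    {A : V → V → Prop} (hA : AcyclicRel A) : ∃ σ : V ≃ Fin n, ∀ a b, A a b → σ b < σ a := by
  let : PartialOrder V :=
    { le := fun a b => Relation.ReflTransGen A b a
      le_refl := fun a => Relation.ReflTransGen.refl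
      le_trans := fun a b c h1 h2 => Relation.ReflTransGen.trans h2 h1
      le_antisymm := fun a b h1 h2 => by
        rcases Relation.reflTransGen_iff_eq_or_transGen.1 h1 with h | h
        · exact h
        · exact absurd (h.trans_left h2) (hA b) }
  obtain ⟨σ, hσ⟩ := exists_strictMono_equiv_fin hn
  refine ⟨σ, fun a b hab => hσ (lt_of_le_of_ne (Relation.ReflTransGen.single hab) ?_)⟩
  rintro rfl
  exact hA b (Relation.TransGen.single hab)

theorem arcLen_add_predSum_le {n : ℕ} {A : Fin n → Fin n → Prop} (hA : AcyclicRel A)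
    {α : Fin n → Fin n} (hα : InGen A α) : arcLen A α + predSum (rnk α) ≤ predSum n + 1 := by
  obtain ⟨σ, hσ⟩ := hA.exists_topological_order (Fintype.card_fin n)
  obtain ⟨w, -, hw, rfl⟩ := hα
  have hp : Function.Injective fun x => (σ x : ℕ) := Fin.val_injective.comp σ.injective
  obtain ⟨w', hsub, heval, hlen⟩ :=
    exists_short_word hp w (fun e he => hσ _ _ (hw e he)) Finset.univ
  have h1 : arcLen A (wordEval w) ≤ w'.length :=
    Nat.sInf_le ⟨w', rfl, fun e he => hw e (hsub he), funext fun x => heval x (by simp)⟩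
  have h2 : ∑ x : Fin n, ((σ x : ℕ) - 1) = predSum n := by
    rw [Equiv.sum_comp σ (fun x : Fin n => (x : ℕ) - 1), predSum,
      Finset.sum_range (fun i => i - 1)]
  have h3 : predSum (rnk (wordEval w)) ≤
      ∑ x ∈ Finset.univ.image (wordEval w), ((σ x : ℕ) - 1) := by
    have h4 : rnk (wordEval w) =
        ((Finset.univ.image (wordEval w)).image fun x => (σ x : ℕ)).card := by
      rw [Finset.card_image_of_injective _ hp, rnk, ← Set.ncard_coe_finset]
      simp
    rw [h4]
    refine (predSum_card_le_sum _).trans ?_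
    rw [Finset.sum_image (hp.injOn)]
  have h5 : (if ∃ e ∈ w', (σ e.1 : ℕ) = 1 then 1 else 0) ≤ 1 := by split_ifs <;> simp
  omega

section LowerBound

/-- The directed path `n - 1 → ⋯ → 1 → 0` together with the edge `2 → 0`. -/
def pathWithChord (n : ℕ) (a b : Fin n) : Prop :=
  (b : ℕ) + 1 = a ∨ ((a : ℕ) = 2 ∧ (b : ℕ) = 0)

theorem pathWithChord.lt {n : ℕ} {a b : Fin n} (h : pathWithChord n a b) : b < a := by
  rcases h with h | h <;> exact Fin.lt_def.2 (by omega)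

theorem acyclicRel_pathWithChord (n : ℕ) : AcyclicRel (pathWithChord n) := by
  have key : ∀ a b, Relation.TransGen (pathWithChord n) a b → b < a := fun a b h => by
    induction h with
    | single h => exact h.lt
    | tail _ h ih => exact h.lt.trans ih
  exact fun v hv => lt_irrefl v (key v v hv)

/-- The target of `x` under the transformation of defect `m` that is slow to reach in
`pathWithChord`: alternately `0` and `1` up to `m + 1`, then a shift by `m`. -/
def slowVal (m x : ℕ) : ℕ :=
  if x ≤ m + 1 then (if x = 0 then 0 else (x + 1) % 2) else x - m

theorem slowVal_le (m x : ℕ) : slowVal m x ≤ x := by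
  unfold slowVal; split_ifs <;> omega

theorem slowVal_succ_ne (m : ℕ) {x : ℕ} (hx : 1 ≤ x) : slowVal m x ≠ slowVal m (x + 1) := by
  unfold slowVal; split_ifs <;> first | contradiction | omega

/-- `slowVal` as a transformation of `Fin n`. -/
def slowMap (n m : ℕ) (x : Fin n) : Fin n := ⟨slowVal m x, (slowVal_le m x).trans_lt x.2⟩

theorem exists_descent_word {n : ℕ} {t c : ℕ} (htc : t ≤ c) (hc : c < n) :
    ∃ w : List (Fin n × Fin n), (∀ e ∈ w, pathWithChord n e.1 e.2) ∧
      ∀ x : Fin n, (wordEval w x).val = if t ≤ x ∧ (x : ℕ) ≤ c then t else x := by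
  induction c, htc using Nat.le_induction with
  | base =>
    refine ⟨[], by simp, fun x => ?_⟩
    change (x : ℕ) = _
    split_ifs <;> omega
  | succ c htc ih =>
    obtain ⟨w, hw, heval⟩ := ih (by omega)
    refine ⟨(⟨c + 1, hc⟩, ⟨c, by omega⟩) :: w, ?_, fun x => ?_⟩
    · intro e he
      rcases List.mem_cons.1 he with rfl | he
      · exact Or.inl rfl
      · exact hw e he
    · rw [wordEval_cons, heval]
      by_cases h : x = ⟨c + 1, hc⟩
      · subst h
        rw [arcMap_self]
        simp only
        split_ifs <;> omega
      · rw [arcMap_of_ne h]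
        have : (x : ℕ) ≠ c + 1 := fun h' => h (Fin.ext h')
        split_ifs <;> omega

/-- One token at `k` can be sent to its target while the tokens below `k` are already at their
targets. -/
theorem exists_slowVal_step {n m k : ℕ} (hk : k < n) :
    ∃ w : List (Fin n × Fin n), (∀ e ∈ w, pathWithChord n e.1 e.2) ∧
      ((∀ x : Fin n, (x : ℕ) = k → (wordEval w x).val = slowVal m k) ∧
      (∀ x : Fin n, k < (x : ℕ) → wordEval w x = x) ∧
      ∀ x : Fin n, ∀ y < k, (x : ℕ) = slowVal m y → wordEval w x = x) := by
  by_cases hlast : 3 ≤ k ∧ slowVal m k = 0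
  · obtain ⟨w, hw, heval⟩ := exists_descent_word (t := 2) (by omega : 2 ≤ k) hk
    have h2 : 2 < n := by omega
    let u : Fin n := ⟨2, h2⟩
    let z : Fin n := ⟨0, by omega⟩
    have hev : ∀ x : Fin n, (wordEval (w ++ [(u, z)]) x).val =
        if 2 ≤ (x : ℕ) ∧ (x : ℕ) ≤ k then 0 else (x : ℕ) := fun x => by
      rw [wordEval_append]
      have h := heval x
      by_cases hx : wordEval w x = u
      · rw [hx] at h ⊢
        rw [show wordEval [(u, z)] u = z from arcMap_self u z]
        simp only [u, z] at h ⊢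
        split_ifs at h ⊢ <;> omega
      · rw [show wordEval [(u, z)] (wordEval w x) = wordEval w x from arcMap_of_ne hx]
        have hx' : (wordEval w x).val ≠ 2 := fun h' => hx (Fin.ext h')
        split_ifs at h ⊢ <;> omega
    refine ⟨w ++ [(u, z)], ?_, fun x hx => ?_, fun x hx => Fin.ext ?_,
      fun x y hy hx => Fin.ext ?_⟩
    · intro e he
      rcases List.mem_append.1 he with he | he
      · exact hw e he
      · rw [List.mem_singleton.1 he]
        exact Or.inr ⟨rfl, rfl⟩
    · rw [hev]; split_ifs <;> omega
    · rw [hev]; split_ifs <;> omega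
    · have : slowVal m y ≤ 1 := by
        have := hlast.2
        unfold slowVal at this ⊢
        split_ifs at this ⊢ <;> omega
      rw [hev]; split_ifs <;> omega
  · obtain ⟨w, hw, heval⟩ := exists_descent_word (slowVal_le m k) hk
    refine ⟨w, hw, fun x hx => ?_, fun x hx => Fin.ext ?_, fun x y hy hx => Fin.ext ?_⟩
    · have := slowVal_le m k
      rw [heval]; split_ifs <;> omega
    · rw [heval]; split_ifs <;> omega
    · have : slowVal m y ≤ slowVal m k := by
        unfold slowVal at hlast ⊢
        split_ifs at hlast ⊢ <;> omega
      rw [heval]; split_ifs <;> omega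

theorem exists_slowMap_prefix (n m k : ℕ) (hk : k ≤ n) :
    ∃ w : List (Fin n × Fin n), (∀ e ∈ w, pathWithChord n e.1 e.2) ∧
      ∀ x : Fin n, (wordEval w x).val = if (x : ℕ) < k then slowVal m x else x := by
  induction k with
  | zero => exact ⟨[], by simp, fun x => rfl⟩
  | succ k ih =>
    obtain ⟨w, hw, heval⟩ := ih (by omega)
    obtain ⟨v, hv, hat, habove, hbelow⟩ := exists_slowVal_step (m := m) (by omega : k < n)
    refine ⟨w ++ v, fun e he => (List.mem_append.1 he).elim (hw e) (hv e), fun x => ?_⟩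
    rw [wordEval_append]
    have h := heval x
    rcases lt_trichotomy (x : ℕ) k with hx | hx | hx
    · rw [if_pos hx] at h
      rw [hbelow _ x hx h, if_pos (by omega), h]
    · rw [if_neg (by omega)] at h
      rw [hat _ (by omega), if_pos (by omega), hx]
    · rw [if_neg (by omega)] at h
      rw [habove _ (by omega), if_neg (by omega), h]

theorem exists_word_slowMap (n m : ℕ) :
    ∃ w : List (Fin n × Fin n), (∀ e ∈ w, pathWithChord n e.1 e.2) ∧
      wordEval w = slowMap n m := by
  obtain ⟨w, hw, heval⟩ := exists_slowMap_prefix n m n le_rfl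
  exact ⟨w, hw, funext fun x => Fin.ext (by rw [heval, if_pos x.2]; rfl)⟩

theorem range_slowMap {n m r : ℕ} (hm : 1 ≤ m) (hr : 2 ≤ r) (hn : n = m + r) :
    Set.range (slowMap n m) = {x : Fin n | (x : ℕ) < r} := by
  ext y
  constructor
  · rintro ⟨x, rfl⟩
    have := x.2
    change slowVal m x < r
    unfold slowVal
    split_ifs <;> omega
  · intro hy
    have hy : (y : ℕ) < r := hy
    have key : ∃ x < n, slowVal m x = y := by
      by_cases h0 : (y : ℕ) = 0
      · exact ⟨0, by omega, by simp [slowVal, h0]⟩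
      by_cases h1 : (y : ℕ) = 1
      · exact ⟨2, by omega, by simp [slowVal, h1, hm]⟩
      · exact ⟨y + m, by omega, by unfold slowVal; split_ifs <;> omega⟩
    obtain ⟨x, hx, h⟩ := key
    exact ⟨⟨x, hx⟩, Fin.ext h⟩

theorem rnk_slowMap {n m r : ℕ} (hm : 1 ≤ m) (hr : 2 ≤ r) (hn : n = m + r) :
    rnk (slowMap n m) = r := by
  rw [rnk, range_slowMap hm hr hn]
  have : {x : Fin n | (x : ℕ) < r} = Set.range (Fin.castLE (by omega : r ≤ n)) := by
    ext x
    simp [Fin.range_castLE]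
  rw [this, ← Set.image_univ, Set.ncard_image_of_injective _ (Fin.castLE_injective _),
    Set.ncard_univ, Nat.card_fin]

theorem sum_slowMap {n m r : ℕ} (hn : n = m + r) :
    ∑ x : Fin n, ((slowMap n m x).val - 1) = predSum r := by
  rw [show ∑ x : Fin n, ((slowMap n m x).val - 1) = ∑ x ∈ Finset.range n, (slowVal m x - 1) from
    (Finset.sum_range fun x => slowVal m x - 1).symm, hn, Finset.sum_range_add, predSum,
    Finset.sum_eq_zero, zero_add]
  · refine Finset.sum_congr rfl fun x _ => ?_
    unfold slowVal
    split_ifs <;> omega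
  · intro x hx
    have := Finset.mem_range.1 hx
    unfold slowVal
    split_ifs <;> omega

/-- Every arc of `pathWithChord` is monotone up to identifying the two lowest vertices. -/
theorem pathWithChord.arcMap_mono {n : ℕ} {a b : Fin n} (hab : pathWithChord n a b) {y z : Fin n}
    (hyz : (y : ℕ) - 1 ≤ (z : ℕ) - 1) : (arcMap a b y).val - 1 ≤ (arcMap a b z).val - 1 := by
  unfold pathWithChord at hab
  by_cases hy : y = a <;> by_cases hz : z = a
  · rw [hy, hz]
  · rw [hy, arcMap_self, arcMap_of_ne hz]
    subst hy
    omega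
  · rw [hz, arcMap_self, arcMap_of_ne hy]
    have : (y : ℕ) ≠ a := fun h => hy (Fin.ext h)
    subst hz
    omega
  · rwa [arcMap_of_ne hy, arcMap_of_ne hz]

/-- If a monotone state still has to be refined to a map separating consecutive tokens, then the
total height exceeds the final one by at most the number of arcs not leaving vertex `1`. -/
theorem sum_le_sum_add_countP {n : ℕ} {α : Fin n → Fin n}
    (hα : ∀ x y : Fin n, 1 ≤ (x : ℕ) → (x : ℕ) + 1 = y → α x ≠ α y) (w : List (Fin n × Fin n))
    (hw : ∀ e ∈ w, pathWithChord n e.1 e.2) (β : Fin n → Fin n)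
    (hβ : ∀ x y : Fin n, x ≤ y → (β x).val - 1 ≤ (β y).val - 1)
    (hβ0 : ∀ x : Fin n, (x : ℕ) = 0 → (β x).val = 0) (hαβ : ∀ x, wordEval w (β x) = α x) :
    ∑ x, ((β x).val - 1) ≤ ∑ x, ((α x).val - 1) + w.countP fun e => (e.1 : ℕ) ≠ 1 := by
  induction w generalizing β with
  | nil =>
    have : β = α := funext hαβ
    simp [this]
  | cons e w ih =>
    have he := hw e (by simp)
    have hlt : (e.2 : ℕ) < e.1 := he.lt
    have hrec := ih (fun e' he' => hw e' (by simp [he'])) (fun x => arcMap e.1 e.2 (β x))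
      (fun x y hxy => he.arcMap_mono (hβ x y hxy))
      (fun x hx => by
        rw [arcMap_of_ne (fun h => by have := hβ0 x hx; rw [h] at this; omega)]
        exact hβ0 x hx) hαβ
    rw [List.countP_cons]
    by_cases h1 : (e.1 : ℕ) = 1
    · have : ∀ x, ((β x).val - 1) ≤ ((arcMap e.1 e.2 (β x)).val - 1) := fun x => by
        by_cases hx : β x = e.1
        · rw [hx, h1]; omega
        · rw [arcMap_of_ne hx]
      have := Finset.sum_le_sum fun x (_ : x ∈ Finset.univ) => this x
      omega
    · have hstep : ∀ x, ((β x).val - 1) ≤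
          ((arcMap e.1 e.2 (β x)).val - 1) + if β x = e.1 then 1 else 0 := fun x => by
        by_cases hx : β x = e.1
        · rw [if_pos hx, hx, arcMap_self]
          unfold pathWithChord at he
          omega
        · rw [if_neg hx, arcMap_of_ne hx, add_zero]
      have hinj : ∀ x y : Fin n, β x = e.1 → β y = e.1 → ¬ x < y := fun x y hx hy hxy => by
        have hlt' : (x : ℕ) < y := hxy
        have hx1 : 1 ≤ (x : ℕ) := by
          by_contra h0
          have := hβ0 x (by omega)
          rw [hx] at this
          omega
        let z : Fin n := ⟨x + 1, by omega⟩
        have hz : β z = e.1 := by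
          have h2 := hβ x z (Fin.le_def.2 (by simp [z]))
          have h3 := hβ z y (Fin.le_def.2 (by simp only [z]; omega))
          rw [hx] at h2
          rw [hy] at h3
          exact Fin.ext (by omega)
        exact hα x z hx1 rfl (by rw [← hαβ, ← hαβ, hx, hz])
      have hcard : ∑ x, (if β x = e.1 then 1 else 0) ≤ 1 := by
        rw [← Finset.card_filter]
        refine Finset.card_le_one.2 fun x hx y hy => ?_
        have hx := (Finset.mem_filter.1 hx).2
        have hy := (Finset.mem_filter.1 hy).2
        exact le_antisymm (not_lt.1 (hinj y x hy hx)) (not_lt.1 (hinj x y hx hy))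
      have hsum := Finset.sum_le_sum fun x (_ : x ∈ Finset.univ) => hstep x
      rw [Finset.sum_add_distrib] at hsum
      simp only [ne_eq, h1, not_false_eq_true, decide_true, if_true]
      simp only [ne_eq] at hrec
      omega

theorem predSum_add_one_le_length {n m r : ℕ} (hm : 1 ≤ m) (hr : 2 ≤ r) (hn : n = m + r)
    {w : List (Fin n × Fin n)} (hw : ∀ e ∈ w, pathWithChord n e.1 e.2)
    (heval : wordEval w = slowMap n m) : predSum n + 1 ≤ w.length + predSum r := by
  have h := sum_le_sum_add_countP (α := slowMap n m)
    (fun x y hx hxy h => slowVal_succ_ne m hx (by rw [hxy]; exact Fin.val_eq_of_eq h)) w hw id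
    (fun x y hxy => Nat.sub_le_sub_right hxy 1) (fun x hx => hx) (fun x => congrFun heval x)
  rw [sum_slowMap hn] at h
  have h1 : ∑ x : Fin n, ((id x).val - 1) = predSum n :=
    (Finset.sum_range (fun i => i - 1)).symm
  rw [h1] at h
  have h2 : 0 < w.countP fun e => ¬ decide ((e.1 : ℕ) ≠ 1) = true := by
    rw [List.countP_pos_iff]
    by_contra! hne
    let x : Fin n := ⟨1, by omega⟩
    have hfix : wordEval w x = x := wordEval_eq_self fun e he hx => by
      have := hne e he
      simp [hx, x] at this
    rw [heval] at hfix
    have : slowVal m 1 = 1 := Fin.val_eq_of_eq hfix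
    simp [slowVal] at this
  have h3 := List.length_eq_countP_add_countP (fun e : Fin n × Fin n => decide ((e.1 : ℕ) ≠ 1))
    (l := w)
  omega

theorem exists_predSum_add_one_le_arcLen {n r : ℕ} (hr : 2 ≤ r) (hrn : r < n) :
    ∃ A : Fin n → Fin n → Prop, AcyclicRel A ∧ ∃ α : Fin n → Fin n, InGen A α ∧ rnk α = r ∧
      predSum n + 1 ≤ arcLen A α + predSum r := by
  have hm : 1 ≤ n - r := by omega
  have hn : n = (n - r) + r := by omega
  obtain ⟨w, hw, heval⟩ := exists_word_slowMap n (n - r)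
  have hne : w ≠ [] := by
    rintro rfl
    have := predSum_add_one_le_length hm hr hn hw heval
    have hle : predSum r ≤ predSum n := Finset.sum_le_sum_of_subset
      (Finset.range_subset_range.2 hrn.le)
    have h1 := two_mul_predSum (n := n) (by omega)
    have h2 : Set.range (slowMap n (n - r)) = Set.univ := by
      rw [← heval]; exact Set.range_id
    have h3 := rnk_slowMap hm hr hn
    rw [rnk, h2, Set.ncard_univ, Nat.card_fin] at h3
    omega
  refine ⟨pathWithChord n, acyclicRel_pathWithChord n, slowMap n (n - r), ⟨w, hne, hw, heval⟩,
    rnk_slowMap hm hr hn, ?_⟩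
  obtain ⟨v, hlen, hv, hveval⟩ := Nat.sInf_mem (s := {k | ∃ w : List (Fin n × Fin n),
    w.length = k ∧ (∀ e ∈ w, pathWithChord n e.1 e.2) ∧ wordEval w = slowMap n (n - r)})
    ⟨w.length, w, rfl, hw, heval⟩
  rw [arcLen, ← hlen]
  exact predSum_add_one_le_length hm hr hn hv hveval

end LowerBound

theorem predSum_eq_add {n r : ℕ} (hr : 2 ≤ r) (hrn : r < n) :
    predSum n = (n - r) * (n + r - 3) / 2 + predSum r := by
  have h1 := two_mul_predSum (n := n) (by omega)
  have h2 := two_mul_predSum (n := r) (by omega)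
  have h3 : (n - r) * (n + r - 3) + (r - 1) * (r - 2) = (n - 1) * (n - 2) := by
    obtain ⟨s, rfl⟩ := Nat.exists_eq_add_of_le' hr
    obtain ⟨m, rfl⟩ := Nat.exists_eq_add_of_le' hrn.le
    simp only [Nat.add_sub_cancel, show m + (s + 2) + (s + 2) - 3 = m + 2 * s + 1 by omega,
      show s + 2 - 1 = s + 1 by omega, show m + (s + 2) - 1 = m + s + 1 by omega,
      show m + (s + 2) - 2 = m + s by omega]
    ring
  omega

theorem predSum_add_one {n : ℕ} (hn : 3 ≤ n) : predSum n + 1 = (n ^ 2 - 3 * n + 4) / 2 := by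
  have h1 := two_mul_predSum (n := n) (by omega)
  have h2 : n ^ 2 - 3 * n + 2 = (n - 1) * (n - 2) := by
    obtain ⟨k, rfl⟩ := Nat.exists_eq_add_of_le' hn
    rw [show (k + 3) ^ 2 = (k * k + 3 * k) + 3 * (k + 3) by ring, Nat.add_sub_cancel,
      show k + 3 - 1 = k + 2 by omega, show k + 3 - 2 = k + 1 by omega]
    ring
  omega

/-- for `n ≥ 3` and `2 ≤ r ≤ n−1`, the maximum of `ℓ(A, α)` over acyclic
simple digraphs `A` on `{1,…,n}` and `α ∈ ⟨A⟩` of rank `r` is `(n−r)(n+r−3)/2 + 1`; the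
maximum over all ranks is `(n² − 3n + 4)/2`, attained at rank `2`. -/
theorem stmt12 (n : ℕ) (hn : 3 ≤ n) (r : ℕ) (hr1 : 2 ≤ r) (hr2 : r ≤ n - 1) :
    IsGreatest {k | ∃ A : Fin n → Fin n → Prop, AcyclicRel A ∧
        ∃ α : Fin n → Fin n, InGen A α ∧ rnk α = r ∧ arcLen A α = k}
      ((n - r) * (n + r - 3) / 2 + 1) ∧
    IsGreatest {k | ∃ A : Fin n → Fin n → Prop, AcyclicRel A ∧
        ∃ α : Fin n → Fin n, InGen A α ∧ arcLen A α = k}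
      ((n ^ 2 - 3 * n + 4) / 2) ∧
    (∃ A : Fin n → Fin n → Prop, AcyclicRel A ∧ ∃ α : Fin n → Fin n, InGen A α ∧
        rnk α = 2 ∧ arcLen A α = (n ^ 2 - 3 * n + 4) / 2) := by
  obtain ⟨A, hA, α, hα, hrk, hlen⟩ := exists_predSum_add_one_le_arcLen hr1 (by omega : r < n)
  obtain ⟨B, hB, β, hβ, hrkβ, hlenβ⟩ := exists_predSum_add_one_le_arcLen le_rfl (by omega : 2 < n)
  have h2 : predSum 2 = 0 := rfl
  have hsum := predSum_eq_add hr1 (by omega : r < n)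
  have hmax := predSum_add_one hn
  have hlenB : arcLen B β = (n ^ 2 - 3 * n + 4) / 2 := by
    have := arcLen_add_predSum_le hB hβ
    omega
  refine ⟨⟨⟨A, hA, α, hα, hrk, ?_⟩, ?_⟩, ⟨⟨B, hB, β, hβ, hlenB⟩, ?_⟩,
    B, hB, β, hβ, hrkβ, hlenB⟩
  · have := arcLen_add_predSum_le hA hα
    rw [hrk] at this
    omega
  · rintro k ⟨C, hC, γ, hγ, hrkγ, rfl⟩
    have := arcLen_add_predSum_le hC hγ
    rw [hrkγ] at this
    omega
  · rintro k ⟨C, hC, γ, hγ, rfl⟩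
    have := arcLen_add_predSum_le hC hγ
    omega
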